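/- arXiv:2203.07337 — 3 statements merged into one kernel-verified Lean document; each statement's English description precedes it below -/
import Mathlib

section
/- Let μ be a probability measure on a measurable space Z, let j : Z → ℝᵖ and σ : Z → ℝ be measurable, and let H be a real symmetric positive semidefinite p×p matrix of rank r ≥ 1 with smallest positive eigenvalue λ_r(H), and let λ > 0. Let D̃ = {z ∈ Z : σ(z)² > 0} and suppose α := μ(D̃) > 0 and that there is σ²_min > 0 with σ(z)² ≥ σ²_min for all z ∈ D̃. Assume z ↦ σ(z)² j(z)ᵀ(H+λI)⁻¹j(z) and z ↦ j(z)j(z)ᵀ are integrable, and let C̃ := (1/α) ∫_{D̃} j(z) j(z)ᵀ dμ(z). Then ∫_Z σ(z)² · j(z)ᵀ (H + λI)⁻¹ j(z) dμ(z) ≥ σ²_min · α · λ_min(C̃) / (λ_r(H) + λ). -/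
open MeasureTheory Matrix
open scoped BigOperators

lemma aux_eig {p : ℕ} (C : Matrix (Fin p) (Fin p) ℝ) (hC : C.IsHermitian) (i : Fin p) :
    ∃ v : Fin p → ℝ, v = (hC.eigenvectorBasis i).ofLp ∧ v ⬝ᵥ v = 1 ∧
      C *ᵥ v = hC.eigenvalues i • v := by
  refine ⟨_, rfl, ?_, hC.mulVec_eigenvectorBasis i⟩
  have h := hC.eigenvectorBasis.orthonormal.1 i
  have h2 := real_inner_self_eq_norm_sq (hC.eigenvectorBasis i)
  rw [h, EuclideanSpace.inner_eq_star_dotProduct] at h2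
  simpa using h2

lemma aux_min {p : ℕ} (C : Matrix (Fin p) (Fin p) ℝ) (hC : C.IsHermitian) (x : Fin p → ℝ) :
    (⨅ i, hC.eigenvalues i) * (x ⬝ᵥ x) ≤ x ⬝ᵥ C *ᵥ x := by
  have hsym : Cᵀ = C := by simpa [Matrix.IsHermitian] using hC
  have key : ∀ y : Fin p → ℝ, x ⬝ᵥ y =
      ∑ i, (x ⬝ᵥ (hC.eigenvectorBasis i).ofLp) * ((hC.eigenvectorBasis i).ofLp ⬝ᵥ y) := by
    intro y
    have h := hC.eigenvectorBasis.sum_inner_mul_inner (WithLp.toLp 2 x) (WithLp.toLp 2 y)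
    simp only [EuclideanSpace.inner_eq_star_dotProduct, star_trivial] at h
    rw [dotProduct_comm x y, ← h]
    refine Finset.sum_congr rfl fun i _ => ?_
    rw [dotProduct_comm x, dotProduct_comm _ y]
  rw [key x, key (C *ᵥ x), Finset.mul_sum]
  refine Finset.sum_le_sum fun i _ => ?_
  have h1 : (hC.eigenvectorBasis i).ofLp ⬝ᵥ C *ᵥ x =
      hC.eigenvalues i * ((hC.eigenvectorBasis i).ofLp ⬝ᵥ x) := by
    rw [dotProduct_mulVec, ← mulVec_transpose, hsym, hC.mulVec_eigenvectorBasis i,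
      smul_dotProduct, smul_eq_mul]
  rw [h1, dotProduct_comm x]
  have h2 : (⨅ i, hC.eigenvalues i) ≤ hC.eigenvalues i :=
    ciInf_le (Set.finite_range _).bddBelow i
  nlinarith [mul_le_mul_of_nonneg_right h2
    (mul_self_nonneg ((hC.eigenvectorBasis i).ofLp ⬝ᵥ x))]

lemma aux_inv {p : ℕ} (H : Matrix (Fin p) (Fin p) ℝ) (hH : H.PosSemidef) (lr lam : ℝ)
    (hlr : 0 < lr) (hlam : 0 < lam) (v : Fin p → ℝ) (hv : v ⬝ᵥ v = 1) (hHv : H *ᵥ v = lr • v)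
    (x : Fin p → ℝ) : 
    0 ≤ x ⬝ᵥ (H + lam • 1)⁻¹ *ᵥ x ∧
    (v ⬝ᵥ x) ^ 2 / (lr + lam) ≤ x ⬝ᵥ (H + lam • 1)⁻¹ *ᵥ x := by
  have hpd : (H + lam • (1 : Matrix (Fin p) (Fin p) ℝ)).PosDef :=
    Matrix.PosDef.posSemidef_add hH (Matrix.PosDef.one.smul hlam)
  have hG := hpd.inv
  set M := H + lam • (1 : Matrix (Fin p) (Fin p) ℝ) with hM
  have hnn : ∀ w : Fin p → ℝ, 0 ≤ w ⬝ᵥ M⁻¹ *ᵥ w := fun w => by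
    simpa using hG.posSemidef.dotProduct_mulVec_nonneg w
  refine ⟨hnn x, ?_⟩
  have hsym : (M⁻¹)ᵀ = M⁻¹ := by simpa [Matrix.IsHermitian] using hG.isHermitian
  have hpos : 0 < lr + lam := by positivity
  have hMv : M *ᵥ v = (lr + lam) • v := by
    rw [hM, add_mulVec, hHv, smul_mulVec, one_mulVec, add_smul]
  have hGv : M⁻¹ *ᵥ v = (lr + lam)⁻¹ • v := by
    have h : M⁻¹ *ᵥ (M *ᵥ v) = v := by
      rw [mulVec_mulVec, nonsing_inv_mul _ ((Matrix.isUnit_iff_isUnit_det _).1 hpd.isUnit), one_mulVec]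
    rw [hMv, mulVec_smul] at h
    rw [eq_inv_smul_iff₀ hpos.ne']; exact h
  have hvG : v ⬝ᵥ M⁻¹ *ᵥ x = (lr + lam)⁻¹ * (v ⬝ᵥ x) := by
    rw [dotProduct_mulVec, ← mulVec_transpose, hsym, hGv, smul_dotProduct, smul_eq_mul]
  have h := hnn (x - (v ⬝ᵥ x) • v)
  simp only [mulVec_sub, mulVec_smul, sub_dotProduct, dotProduct_sub, smul_dotProduct,
    dotProduct_smul, hvG, hGv, smul_eq_mul, hv, dotProduct_comm x v] at h
  rw [div_eq_mul_inv]
  nlinarith [h]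

/-- (Core inequality of Theorem 2 of the paper: lower bound on the
complexity term of the population risk.)  Let `μ` be a probability measure on `Z`,
`j : Z → ℝᵖ` and `σ : Z → ℝ` measurable, `H` real symmetric positive semidefinite of
rank `r ≥ 1` with smallest positive eigenvalue `lr`, and `λ > 0`.  Let
`D̃ = {z | σ(z)² > 0}`, `α = μ(D̃) > 0`, and suppose `σ(z)² ≥ σ²min > 0` on `D̃`.
Assuming the stated integrability, and with
`C̃ = α⁻¹ ∫_{D̃} j jᵀ dμ`, we have
`∫ σ(z)² jᵀ (H + λI)⁻¹ j dμ ≥ σ²min · α · λmin(C̃) / (λ_r(H) + λ)`. -/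
theorem population_risk_lower_bound {Z : Type*} [MeasurableSpace Z]
    (μ : Measure Z) [IsProbabilityMeasure μ]
    {p : ℕ} (j : Z → Fin p → ℝ) (σ : Z → ℝ)
    (hj : Measurable j) (hσ : Measurable σ)
    (H : Matrix (Fin p) (Fin p) ℝ) (hH : H.PosSemidef)
    (r : ℕ) (hr : 1 ≤ r) (hrank : H.rank = r)
    (lr : ℝ) (hlr_pos : 0 < lr)
    (hlr_eig : ∃ i, hH.isHermitian.eigenvalues i = lr)
    (hlr_min : ∀ i, 0 < hH.isHermitian.eigenvalues i →
      lr ≤ hH.isHermitian.eigenvalues i)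
    (lam : ℝ) (hlam : 0 < lam)
    (Dt : Set Z) (hDt : Dt = {z | 0 < σ z ^ 2})
    (α : ℝ) (hα : α = (μ Dt).toReal) (hαpos : 0 < α)
    (σsqmin : ℝ) (hσsqmin : 0 < σsqmin)
    (hbound : ∀ z ∈ Dt, σsqmin ≤ σ z ^ 2)
    (hint1 : Integrable
      (fun z => σ z ^ 2 * (j z ⬝ᵥ ((H + lam • 1)⁻¹).mulVec (j z))) μ)
    (hint2 : ∀ i k, Integrable (fun z => j z i * j z k) μ)
    (Ct : Matrix (Fin p) (Fin p) ℝ)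
    (hCt : Ct = α⁻¹ • Matrix.of fun i k => ∫ z in Dt, j z i * j z k ∂μ)
    (hCtherm : Ct.IsHermitian) :
    σsqmin * α * (⨅ i, hCtherm.eigenvalues i) / (lr + lam)
      ≤ ∫ z, σ z ^ 2 * (j z ⬝ᵥ ((H + lam • 1)⁻¹).mulVec (j z)) ∂μ := by
  obtain ⟨i0, hi0⟩ := hlr_eig
  obtain ⟨v, -, hv, hHv⟩ := aux_eig H hH.isHermitian i0
  rw [hi0] at hHv
  have hA := fun x => aux_inv H hH lr lam hlr_pos hlam v hv hHv x
  have hpos : 0 < lr + lam := by positivity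
  have hm := aux_min Ct hCtherm v
  rw [hv, mul_one] at hm
  have hexp : ∀ z, (v ⬝ᵥ j z) ^ 2 = ∑ i, ∑ k, v i * v k * (j z i * j z k) := by
    intro z
    rw [sq, dotProduct, Finset.sum_mul_sum]
    refine Finset.sum_congr rfl fun i _ => Finset.sum_congr rfl fun k _ => by ring
  have hintv : Integrable (fun z => (v ⬝ᵥ j z) ^ 2) μ := by
    simp only [hexp]
    exact integrable_finset_sum _ fun i _ => integrable_finset_sum _ fun k _ =>
      (hint2 i k).const_mul _
  have hCv : α * (v ⬝ᵥ Ct *ᵥ v) = ∫ z in Dt, (v ⬝ᵥ j z) ^ 2 ∂μ := by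
    simp only [hexp]
    rw [integral_finset_sum _ fun i _ => integrable_finset_sum _ fun k _ =>
      ((hint2 i k).const_mul _).integrableOn]
    rw [hCt, smul_mulVec, dotProduct_smul, smul_eq_mul, ← mul_assoc,
      mul_inv_cancel₀ hαpos.ne', one_mul]
    simp only [dotProduct, mulVec, Matrix.of_apply, Finset.mul_sum]
    refine Finset.sum_congr rfl fun i _ => ?_
    rw [integral_finset_sum _ fun k _ => ((hint2 i k).const_mul _).integrableOn]
    refine Finset.sum_congr rfl fun k _ => ?_
    rw [integral_const_mul]; ring
  calc σsqmin * α * (⨅ i, hCtherm.eigenvalues i) / (lr + lam)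
      ≤ σsqmin * α * (v ⬝ᵥ Ct *ᵥ v) / (lr + lam) := by gcongr
    _ = ∫ z in Dt, σsqmin / (lr + lam) * (v ⬝ᵥ j z) ^ 2 ∂μ := by
        rw [integral_const_mul, ← hCv]; ring
    _ ≤ ∫ z in Dt, σ z ^ 2 * (j z ⬝ᵥ ((H + lam • 1)⁻¹).mulVec (j z)) ∂μ := by
        refine setIntegral_mono_on (hintv.const_mul _).integrableOn hint1.integrableOn ?_ ?_
        · rw [hDt]; exact measurableSet_lt measurable_const (hσ.pow_const 2)
        · intro z hz
          calc σsqmin / (lr + lam) * (v ⬝ᵥ j z) ^ 2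
              = σsqmin * ((v ⬝ᵥ j z) ^ 2 / (lr + lam)) := by ring
            _ ≤ _ := mul_le_mul (hbound z hz) (hA (j z)).2 (by positivity) (sq_nonneg _)
    _ ≤ _ := setIntegral_le_integral hint1
        (Filter.Eventually.of_forall fun z => mul_nonneg (sq_nonneg _) (hA (j z)).1)
end

section
/- Let μ be a probability measure on a measurable space Z, let j : Z → ℝᵖ and σ : Z → ℝ be measurable, and let H be a real symmetric positive semidefinite p×p matrix and λ > 0. Let D̃ = {z ∈ Z : σ(z)² > 0}, let α := μ(D̃), and suppose there is σ²_max < ∞ with σ(z)² ≤ σ²_max for all z ∈ D̃. Assume z ↦ σ(z)² j(z)ᵀ(H+λI)⁻¹j(z) and z ↦ j(z)j(z)ᵀ are integrable, α > 0, and let C̃ := (1/α) ∫_{D̃} j(z) j(z)ᵀ dμ(z). Then ∫_Z σ(z)² · j(z)ᵀ (H + λI)⁻¹ j(z) dμ(z) ≤ σ²_max · α · λ_max(C̃) · Tr( (H + λI)⁻¹ ). -/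
open MeasureTheory Matrix
open scoped BigOperators

open scoped MatrixOrder in
lemma psd_trace_mul_nonneg {p : ℕ} (A B : Matrix (Fin p) (Fin p) ℝ)
    (hA : A.PosSemidef) (hB : B.PosSemidef) : 0 ≤ (A * B).trace := by
  obtain ⟨X, rfl⟩ := CStarAlgebra.nonneg_iff_eq_star_mul_self.1 hA.nonneg
  rw [Matrix.star_eq_conjTranspose, Matrix.mul_assoc, Matrix.trace_mul_comm]
  exact (hB.mul_mul_conjTranspose_same X).trace_nonneg

lemma sup_sub_psd {p : ℕ} (C : Matrix (Fin p) (Fin p) ℝ) (hC : C.IsHermitian) :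
    ((⨆ i, hC.eigenvalues i) • (1 : Matrix (Fin p) (Fin p) ℝ) - C).PosSemidef := by
  set c := ⨆ i, hC.eigenvalues i with hc
  have hD : (Matrix.diagonal (fun i => c - hC.eigenvalues i)).PosSemidef := by
    refine Matrix.PosSemidef.diagonal fun i => ?_
    have := le_ciSup (Set.finite_range hC.eigenvalues).bddAbove i
    simp only [Pi.zero_apply]
    linarith
  have h := hD.mul_mul_conjTranspose_same (hC.eigenvectorUnitary : Matrix (Fin p) (Fin p) ℝ)
  have hs := hC.spectral_theorem
  rw [Unitary.conjStarAlgAut_apply] at hs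
  have hU : (hC.eigenvectorUnitary : Matrix (Fin p) (Fin p) ℝ) *
      star (hC.eigenvectorUnitary : Matrix (Fin p) (Fin p) ℝ) = 1 :=
    Unitary.coe_mul_star_self _
  have hd : Matrix.diagonal (fun i => c - hC.eigenvalues i)
      = c • (1 : Matrix (Fin p) (Fin p) ℝ) - Matrix.diagonal (RCLike.ofReal ∘ hC.eigenvalues) := by
    rw [Matrix.smul_one_eq_diagonal, Matrix.diagonal_sub]
    rfl
  rw [hd, ← Matrix.star_eq_conjTranspose, mul_sub, sub_mul, ← hs] at h
  simpa [hU] using h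

/-- (Analogous upper bound from Appendix A of the paper.)
Let `μ` be a probability measure on `Z`, `j : Z → ℝᵖ` and `σ : Z → ℝ` measurable,
`H` real symmetric positive semidefinite, `λ > 0`.  Let `D̃ = {z | σ(z)² > 0}`,
`α = μ(D̃) > 0`, and suppose `σ(z)² ≤ σ²max < ∞` on `D̃`.  Assuming the stated
integrability, with `C̃ = α⁻¹ ∫_{D̃} j jᵀ dμ` we have
`∫ σ(z)² jᵀ (H + λI)⁻¹ j dμ ≤ σ²max · α · λmax(C̃) · Tr((H + λI)⁻¹)`. -/
theorem population_risk_upper_bound {Z : Type*} [MeasurableSpace Z]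
    (μ : Measure Z) [IsProbabilityMeasure μ]
    {p : ℕ} (j : Z → Fin p → ℝ) (σ : Z → ℝ)
    (hj : Measurable j) (hσ : Measurable σ)
    (H : Matrix (Fin p) (Fin p) ℝ) (hH : H.PosSemidef)
    (lam : ℝ) (hlam : 0 < lam)
    (Dt : Set Z) (hDt : Dt = {z | 0 < σ z ^ 2})
    (α : ℝ) (hα : α = (μ Dt).toReal) (hαpos : 0 < α)
    (σsqmax : ℝ) (hbound : ∀ z ∈ Dt, σ z ^ 2 ≤ σsqmax)
    (hint1 : Integrable
      (fun z => σ z ^ 2 * (j z ⬝ᵥ ((H + lam • 1)⁻¹).mulVec (j z))) μ)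
    (hint2 : ∀ i k, Integrable (fun z => j z i * j z k) μ)
    (Ct : Matrix (Fin p) (Fin p) ℝ)
    (hCt : Ct = α⁻¹ • Matrix.of fun i k => ∫ z in Dt, j z i * j z k ∂μ)
    (hCtherm : Ct.IsHermitian) :
    ∫ z, σ z ^ 2 * (j z ⬝ᵥ ((H + lam • 1)⁻¹).mulVec (j z)) ∂μ
      ≤ σsqmax * α * (⨆ i, hCtherm.eigenvalues i) * ((H + lam • 1)⁻¹).trace := by
  set A := (H + lam • (1 : Matrix (Fin p) (Fin p) ℝ))⁻¹ with hAdef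
  have hA : A.PosSemidef :=
    (hH.add (Matrix.PosSemidef.one.smul hlam.le)).inv
  have hDm : MeasurableSet Dt := by
    rw [hDt]
    exact measurableSet_lt measurable_const (hσ.pow_const 2)
  have hs0 : 0 ≤ σsqmax := by
    have hne : Dt.Nonempty := by
      by_contra h
      rw [Set.not_nonempty_iff_eq_empty] at h
      rw [h] at hα
      simp at hα
      linarith
    obtain ⟨z, hz⟩ := hne
    exact (sq_nonneg _).trans (hbound z hz)
  have hq0 : ∀ z, 0 ≤ j z ⬝ᵥ A.mulVec (j z) := fun z => by
    simpa using hA.dotProduct_mulVec_nonneg (j z)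
  have hexp : ∀ z, j z ⬝ᵥ A.mulVec (j z) = ∑ i, ∑ k, A i k * (j z k * j z i) := fun z => by
    simp only [dotProduct, Matrix.mulVec, Finset.mul_sum]
    exact Finset.sum_congr rfl fun i _ => Finset.sum_congr rfl fun k _ => by ring
  have hqi : Integrable (fun z => j z ⬝ᵥ A.mulVec (j z)) μ := by
    simp only [hexp]
    exact integrable_finsetSum _ fun i _ => integrable_finsetSum _ fun k _ =>
      (hint2 k i).const_mul _
  have h1 : ∫ z, σ z ^ 2 * (j z ⬝ᵥ A.mulVec (j z)) ∂μ
      ≤ ∫ z in Dt, σsqmax * (j z ⬝ᵥ A.mulVec (j z)) ∂μ := by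
    rw [← setIntegral_eq_integral_of_forall_compl_eq_zero (s := Dt)]
    · exact setIntegral_mono_on hint1.integrableOn (hqi.const_mul _).integrableOn hDm
        fun z hz => mul_le_mul_of_nonneg_right (hbound z hz) (hq0 z)
    · intro z hz
      have : σ z ^ 2 = 0 := by
        rw [hDt] at hz
        exact le_antisymm (not_lt.1 hz) (sq_nonneg _)
      rw [this, zero_mul]
  have h2 : ∫ z in Dt, j z ⬝ᵥ A.mulVec (j z) ∂μ = α * (A * Ct).trace := by
    simp only [hexp]
    have hi : ∀ i k, Integrable (fun z => A i k * (j z k * j z i)) (μ.restrict Dt) :=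
      fun i k => ((hint2 k i).const_mul _).integrableOn
    refine (integral_finsetSum Finset.univ fun i _ =>
      integrable_finsetSum Finset.univ fun k _ => hi i k).trans ?_
    simp only [Matrix.trace, Matrix.diag, Matrix.mul_apply, Finset.mul_sum]
    refine Finset.sum_congr rfl fun i _ => ?_
    refine (integral_finsetSum Finset.univ fun k _ => hi i k).trans ?_
    refine Finset.sum_congr rfl fun k _ => ?_
    rw [integral_const_mul, hCt]
    simp only [Matrix.smul_apply, Matrix.of_apply, smul_eq_mul]
    field_simp
  have h3 := psd_trace_mul_nonneg A _ hA (sup_sub_psd Ct hCtherm)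
  rw [mul_sub, Matrix.trace_sub, Matrix.mul_smul, mul_one, Matrix.trace_smul, smul_eq_mul] at h3
  rw [integral_const_mul, h2] at h1
  refine h1.trans ?_
  have := mul_le_mul_of_nonneg_left (sub_nonneg.1 h3) (mul_nonneg hs0 hαpos.le)
  linarith
end

section
/- Let X ∈ ℝ^{n×d} have rows x₁, …, xₙ, assume Σ := XᵀX is invertible, let y ∈ ℝⁿ, and let θ = (XᵀX)⁻¹ Xᵀ y be the ordinary least-squares solution. For each i, set rᵢ := θᵀxᵢ − yᵢ and Aᵢᵢ := xᵢᵀ Σ⁻¹ xᵢ, and assume Aᵢᵢ ≠ 1 for all i. Then Σ − xᵢxᵢᵀ = Σ_{j≠i} xⱼxⱼᵀ is invertible; define Δθ⁽ⁱ⁾ := (Σ_{j≠i} xⱼxⱼᵀ)⁻¹ · rᵢ xᵢ. With per-sample loss ℓᵢ(θ) = (θᵀxᵢ − yᵢ)², the second-order leave-one-out estimate satisfies (1/n) Σᵢ [ ℓᵢ(θ) + ∇ℓᵢ(θ)ᵀ Δθ⁽ⁱ⁾ + ½ (Δθ⁽ⁱ⁾)ᵀ ∇²ℓᵢ(θ)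 Δθ⁽ⁱ⁾ ] = (1/n) Σᵢ ( rᵢ / (1 − Aᵢᵢ) )², which is the classical closed-form leave-one-out formula for least squares. -/
open Matrix Finset
open scoped BigOperators

/-- (Theorem 4 of the paper: the second-order influence-function
leave-one-out estimate recovers the classical closed-form leave-one-out formula for
ordinary least squares.)  Let `X ∈ ℝ^{n×d}` with rows `xᵢ`, `Σ = XᵀX` invertible,
`θ = (XᵀX)⁻¹Xᵀy`, residuals `rᵢ = θᵀxᵢ - yᵢ`, hat-matrix diagonal
`Aᵢᵢ = xᵢᵀ Σ⁻¹ xᵢ ≠ 1`, and `Δθ⁽ⁱ⁾ = (Σ - xᵢxᵢᵀ)⁻¹ (rᵢ xᵢ)`.  Then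
`Σ - xᵢxᵢᵀ = ∑_{j ≠ i} xⱼxⱼᵀ` is invertible, and with per-sample loss
`ℓᵢ(θ) = (θᵀxᵢ - yᵢ)²` (so `∇ℓᵢ(θ) = 2rᵢxᵢ` and `∇²ℓᵢ(θ) = 2xᵢxᵢᵀ`), the
second-order leave-one-out estimate equals `(1/n) ∑ᵢ (rᵢ/(1-Aᵢᵢ))²`. -/
theorem loo_least_squares {n d : ℕ}
    (X : Matrix (Fin n) (Fin d) ℝ)
    (Sig : Matrix (Fin d) (Fin d) ℝ) (hSig : Sig = Xᵀ * X) (hinv : IsUnit Sig)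
    (y : Fin n → ℝ)
    (θ : Fin d → ℝ) (hθ : θ = (Sig⁻¹ * Xᵀ).mulVec y)
    (r : Fin n → ℝ) (hres : ∀ i, r i = θ ⬝ᵥ X i - y i)
    (A : Fin n → ℝ) (hA : ∀ i, A i = X i ⬝ᵥ Sig⁻¹.mulVec (X i))
    (hA1 : ∀ i, A i ≠ 1)
    (dθ : Fin n → Fin d → ℝ)
    (hdθ : ∀ i, dθ i = ((Sig - vecMulVec (X i) (X i))⁻¹).mulVec (r i • X i)) :
    (∀ i, Sig - vecMulVec (X i) (X i)
        = ∑ j ∈ univ.erase i, vecMulVec (X j) (X j)) ∧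
    (∀ i, IsUnit (Sig - vecMulVec (X i) (X i))) ∧
    (1 / n : ℝ) * ∑ i, (r i ^ 2 + ((2 * r i) • X i) ⬝ᵥ dθ i
        + (1 / 2 : ℝ) * (dθ i ⬝ᵥ ((2 : ℝ) • vecMulVec (X i) (X i)).mulVec (dθ i)))
      = (1 / n : ℝ) * ∑ i, (r i / (1 - A i)) ^ 2 := by
  have key : ∀ i (v : Fin d → ℝ) (c : ℝ),
      (Sig - vecMulVec (X i) (X i)).mulVec v = c • X i →
      v = (X i ⬝ᵥ v + c) • Sig⁻¹.mulVec (X i) := by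
    intro i v c h
    have hdet : IsUnit Sig.det := (Matrix.isUnit_iff_isUnit_det _).1 hinv
    have hv : (vecMulVec (X i) (X i)).mulVec v = (X i ⬝ᵥ v) • X i := by
      rw [Matrix.vecMulVec_mulVec]
      ext k
      simp [mul_comm]
    rw [Matrix.sub_mulVec, hv, sub_eq_iff_eq_add, ← add_smul] at h
    have h2 := congrArg (fun w => Sig⁻¹.mulVec w) h
    simp only [Matrix.mulVec_mulVec, Matrix.nonsing_inv_mul _ hdet, Matrix.one_mulVec,
      Matrix.mulVec_smul] at h2
    rw [add_comm]
    exact h2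
  have key2 : ∀ i (v : Fin d → ℝ) (c : ℝ),
      (Sig - vecMulVec (X i) (X i)).mulVec v = c • X i →
      X i ⬝ᵥ v = (X i ⬝ᵥ v + c) * A i := by
    intro i v c h
    have h2 := congrArg (fun w => X i ⬝ᵥ w) (key i v c h)
    simp only [dotProduct_smul, smul_eq_mul, ← hA] at h2
    exact h2
  have hunit : ∀ i, IsUnit (Sig - vecMulVec (X i) (X i)) := by
    intro i
    rw [← Matrix.mulVec_injective_iff_isUnit]
    intro v w hvw
    have h0 : (Sig - vecMulVec (X i) (X i)).mulVec (v - w) = (0 : ℝ) • X i := by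
      rw [Matrix.mulVec_sub, zero_smul]
      exact sub_eq_zero.2 hvw
    have h1 := key2 i _ _ h0
    have h2 : X i ⬝ᵥ (v - w) = 0 := by
      have h3 : X i ⬝ᵥ (v - w) * (1 - A i) = 0 := by linarith
      exact (mul_eq_zero.1 h3).resolve_right (sub_ne_zero.2 (hA1 i).symm)
    have h4 := key i _ _ h0
    rw [h2, add_zero, zero_smul] at h4
    exact sub_eq_zero.1 h4
  refine ⟨?_, hunit, ?_⟩
  · intro i
    rw [sub_eq_iff_eq_add, Finset.sum_erase_add _ _ (Finset.mem_univ i), hSig]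
    ext a b
    simp [Matrix.mul_apply, Matrix.sum_apply, vecMulVec_apply]
  · congr 1
    refine Finset.sum_congr rfl fun i _ => ?_
    have hM : (Sig - vecMulVec (X i) (X i)).mulVec (dθ i) = r i • X i := by
      rw [hdθ, Matrix.mulVec_mulVec,
        Matrix.mul_nonsing_inv _ ((Matrix.isUnit_iff_isUnit_det _).1 (hunit i)),
        Matrix.one_mulVec]
    have ht := key2 i _ _ hM
    have hq : dθ i ⬝ᵥ ((2 : ℝ) • vecMulVec (X i) (X i)).mulVec (dθ i)
        = 2 * (X i ⬝ᵥ dθ i) ^ 2 := by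
      have hv : (vecMulVec (X i) (X i)).mulVec (dθ i) = (X i ⬝ᵥ dθ i) • X i := by
        rw [Matrix.vecMulVec_mulVec]
        ext k
        simp [mul_comm]
      rw [Matrix.smul_mulVec, hv, dotProduct_smul, dotProduct_smul, dotProduct_comm (dθ i)]
      simp only [smul_eq_mul]
      ring
    rw [hq, smul_dotProduct, smul_eq_mul]
    have hne : 1 - A i ≠ 0 := sub_ne_zero.2 (hA1 i).symm
    have hr : r i / (1 - A i) = X i ⬝ᵥ dθ i + r i := by
      rw [div_eq_iff hne]
      linarith
    rw [hr]
    ring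
end
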